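/- If each room has only 2 configurations (a single switch), n ≥ 2 prisoners, and r ≥ 5 rooms, then there is no winning strategy: for every deterministic strategy there is a valid schedule under which the prisoners either declare incorrectly or never declare, even when the initial configurations are all known to be Off. -/

import Mathlib

/-- A prisoner's observation history: the list of (configuration seen on entry,
configuration left on exit) for each of his visits so far. -/
abbrev Hist (C : Type) := List (C × C)

/-- A deterministic strategy: for each prisoner, a function from his history
and the configuration of the room he enters to the configuration he leaves the
room in, together with whether he declares. -/
abbrev Strategy (n : ℕ) (C : Type) := Fin n → Hist C → C → C × Bool

/-- A schedule: who visits which room at each step. -/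
abbrev Schedule (n r : ℕ) := ℕ → Fin n × Fin r

/-- Global state of an execution. -/
structure PState (n r : ℕ) (C : Type) where
  rooms : Fin r → C
  hist : Fin n → Hist C
  declared : Bool

/-- One visit of prisoner `v.1` to room `v.2`. -/
def pstep {n r : ℕ} {C : Type} (σ : Strategy n C) (v : Fin n × Fin r)
    (s : PState n r C) : PState n r C :=
  let cur := s.rooms v.2
  let a := σ v.1 (s.hist v.1) cur
  { rooms := Function.update s.rooms v.2 a.1
    hist := Function.update s.hist v.1 (s.hist v.1 ++ [(cur, a.1)])
    declared := s.declared || a.2 }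

/-- The state after `t` visits, starting from initial room configurations `init`. -/
def prun {n r : ℕ} {C : Type} (σ : Strategy n C) (sch : Schedule n r)
    (init : Fin r → C) : ℕ → PState n r C
  | 0 => ⟨init, fun _ => [], false⟩
  | t + 1 => pstep σ (sch t) (prun σ sch init t)

/-- A schedule is valid if every prisoner visits every room infinitely often. -/
def ValidSchedule {n r : ℕ} (sch : Schedule n r) : Prop :=
  ∀ (p : Fin n) (rm : Fin r), {t | sch t = (p, rm)}.Infinite

/-- Prisoner `p` has visited room `rm` within the first `t` visits. -/
def VisitedBy {n r : ℕ} (sch : Schedule n r) (t : ℕ) (p : Fin n) (rm : Fin r) : Prop :=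
  ∃ t' < t, sch t' = (p, rm)

/-- A strategy is winning for initial configurations `init` if under every
valid schedule some prisoner eventually declares, and every declaration occurs
only after each prisoner has visited every room at least once. -/
def Winning {n r : ℕ} {C : Type} (σ : Strategy n C) (init : Fin r → C) : Prop :=
  ∀ sch : Schedule n r, ValidSchedule sch →
    (∃ t, (prun σ sch init t).declared = true) ∧
    (∀ t, (prun σ sch init t).declared = true → ∀ p rm, VisitedBy sch t p rm)

namespace OneSwitch

/-- The number of rooms in configuration `v`. -/
def count {r : ℕ} (ρ : Fin r → Bool) (v : Bool) : ℕ :=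
  (Finset.univ.filter fun i => ρ i = v).card

section Count

variable {r : ℕ} (ρ : Fin r → Bool)

lemma count_add_count_not (v : Bool) : count ρ v + count ρ (!v) = r := by
  have h := Finset.card_filter_add_card_filter_not (s := (Finset.univ : Finset (Fin r)))
    (fun i => ρ i = v)
  simpa [count, Bool.eq_not] using h

lemma count_update (i : Fin r) (c v : Bool) :
    count (Function.update ρ i c) v + (if ρ i = v then 1 else 0)
      = count ρ v + (if c = v then 1 else 0) := by
  have h1 := Finset.add_sum_erase Finset.univ (fun j => if ρ j = v then 1 else 0)
    (Finset.mem_univ i)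
  have h2 := Finset.add_sum_erase Finset.univ
    (fun j => if Function.update ρ i c j = v then 1 else 0) (Finset.mem_univ i)
  have h3 : ∑ j ∈ Finset.univ.erase i, (if Function.update ρ i c j = v then 1 else 0)
      = ∑ j ∈ Finset.univ.erase i, (if ρ j = v then 1 else 0) := by
    refine Finset.sum_congr rfl fun j hj => ?_
    rw [Function.update_of_ne (Finset.ne_of_mem_erase hj)]
  simp only [Function.update_self] at h2
  simp only [count, Finset.card_filter]
  omega

lemma exists_of_count_pos {v : Bool} (h : 1 ≤ count ρ v) : ∃ j, ρ j = v := by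
  obtain ⟨j, hj⟩ := Finset.card_pos.1 h
  exact ⟨j, by simpa using hj⟩

lemma exists_ne_of_two_le_count {v : Bool} (h : 2 ≤ count ρ v) (i : Fin r) :
    ∃ j, j ≠ i ∧ ρ j = v := by
  obtain ⟨j, hj, hji⟩ := Finset.exists_mem_ne (show 1 < _ from h) i
  exact ⟨j, hji, by simpa using hj⟩

lemma count_pos (i : Fin r) : 1 ≤ count ρ (ρ i) :=
  Finset.card_pos.2 ⟨i, by simp⟩

end Count

section Run

variable {n r : ℕ} (σ : Strategy n Bool)

/-- The state reached from `s` after the visits listed in `l`. -/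
def run (s : PState n r Bool) (l : List (Fin n × Fin r)) : PState n r Bool :=
  l.foldl (fun s v => pstep σ v s) s

/-- The initial state: every room is Off and nobody has seen anything. -/
def start (n r : ℕ) : PState n r Bool := ⟨fun _ => false, fun _ => [], false⟩

lemma run_append (s : PState n r Bool) (l m : List (Fin n × Fin r)) :
    run σ s (l ++ m) = run σ (run σ s l) m := by
  simp [run]

lemma run_singleton (s : PState n r Bool) (v : Fin n × Fin r) :
    run σ s [v] = pstep σ v s := rfl

lemma prun_eq_run (sch : Schedule n r) (t : ℕ) :
    prun σ sch (fun _ => false) t = run σ (start n r) ((List.range t).map sch) := by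
  induction t with
  | zero => rfl
  | succ t ih => rw [List.range_succ, List.map_append, run_append, ← ih]; rfl

lemma prun_length_eq_run {sch : Schedule n r} {l : List (Fin n × Fin r)}
    (h : ∀ t (ht : t < l.length), sch t = l[t]) :
    prun σ sch (fun _ => false) l.length = run σ (start n r) l := by
  rw [prun_eq_run]
  congr 1
  exact List.ext_getElem (by simp) fun t h1 h2 => by simp [h t h2]

lemma declared_mono (sch : Schedule n r) {t u : ℕ} (htu : t ≤ u)
    (h : (prun σ sch (fun _ => false) t).declared = true) :
    (prun σ sch (fun _ => false) u).declared = true := by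
  induction u, htu using Nat.le_induction with
  | base => exact h
  | succ u _ ih => simp [prun, pstep, ih]

/-- The configuration in which prisoner `p` leaves a room seen in configuration `c`. -/
def resp (s : PState n r Bool) (p : Fin n) (c : Bool) : Bool := (σ p (s.hist p) c).1

/-- Some sequence of visits looks to everybody like `s`, has the same number of rooms in each
configuration, and leaves some room, in configuration `x`, unvisited by `q`. -/
def Alt (s : PState n r Bool) (q : Fin n) (x : Bool) : Prop :=
  ∃ l, (run σ (start n r) l).hist = s.hist ∧ (run σ (start n r) l).declared = s.declared ∧
    count (run σ (start n r) l).rooms = count s.rooms ∧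
    ∃ X, (run σ (start n r) l).rooms X = x ∧ (q, X) ∉ l

variable {σ} {s : PState n r Bool} {p q : Fin n} {i : Fin r} {c x : Bool}

lemma count_pstep (v : Bool) :
    count (pstep σ (p, i) s).rooms v + (if s.rooms i = v then 1 else 0)
      = count s.rooms v + (if resp σ s p (s.rooms i) = v then 1 else 0) :=
  count_update _ _ _ _

lemma count_pstep_of_eq (h : resp σ s p (s.rooms i) = s.rooms i) (v : Bool) :
    count (pstep σ (p, i) s).rooms v = count s.rooms v := by
  have := count_pstep (σ := σ) (s := s) (p := p) (i := i) v
  rw [h] at this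
  omega

lemma count_pstep_of_flip (hc : s.rooms i = c) (h : resp σ s p c = !c) :
    count (pstep σ (p, i) s).rooms c + 1 = count s.rooms c ∧
      count (pstep σ (p, i) s).rooms (!c) = count s.rooms (!c) + 1 := by
  have h1 := count_pstep (σ := σ) (s := s) (p := p) (i := i) c
  have h2 := count_pstep (σ := σ) (s := s) (p := p) (i := i) (!c)
  rw [hc, h] at h1 h2
  cases c <;> simp_all

lemma alt_pstep_aux {l : List (Fin n × Fin r)} {j : Fin r}
    (hh : (run σ (start n r) l).hist = s.hist)
    (hd : (run σ (start n r) l).declared = s.declared)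
    (hc : count (run σ (start n r) l).rooms = count s.rooms)
    (hj : (run σ (start n r) l).rooms j = s.rooms i) :
    (run σ (start n r) (l ++ [(p, j)])).hist = (pstep σ (p, i) s).hist ∧
    (run σ (start n r) (l ++ [(p, j)])).declared = (pstep σ (p, i) s).declared ∧
    count (run σ (start n r) (l ++ [(p, j)])).rooms = count (pstep σ (p, i) s).rooms := by
  rw [run_append, run_singleton]
  refine ⟨by simp [pstep, hh, hj], by simp [pstep, hh, hd, hj], funext fun v => ?_⟩
  have h1 := count_pstep (σ := σ) (s := run σ (start n r) l) (p := p) (i := j) v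
  have h2 := count_pstep (σ := σ) (s := s) (p := p) (i := i) v
  have hresp : resp σ (run σ (start n r) l) p (s.rooms i) = resp σ s p (s.rooms i) := by
    simp [resp, hh]
  rw [hj, hc, hresp] at h1
  omega

/-- A visit to a room other than the avoided one. -/
lemma Alt.keep (h : Alt σ s q x) (hx : x = s.rooms i → 2 ≤ count s.rooms (s.rooms i)) :
    Alt σ (pstep σ (p, i) s) q x := by
  obtain ⟨l, hh, hd, hc, X, hX, hq⟩ := h
  obtain ⟨j, hjX, hj⟩ : ∃ j, j ≠ X ∧ (run σ (start n r) l).rooms j = s.rooms i := by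
    by_cases hxi : x = s.rooms i
    · exact exists_ne_of_two_le_count _ (hc ▸ hx hxi) X
    · obtain ⟨j, hj⟩ := exists_of_count_pos (run σ (start n r) l).rooms (hc ▸ count_pos s.rooms i)
      exact ⟨j, fun h => hxi (by rw [← hj, h, hX]), hj⟩
  obtain ⟨h1, h2, h3⟩ := alt_pstep_aux (p := p) hh hd hc hj
  refine ⟨_, h1, h2, h3, X, ?_, ?_⟩
  · rw [run_append, run_singleton]
    simp [pstep, Function.update_of_ne hjX.symm, hX]
  · simp [hq, hjX.symm]

/-- A visit of another prisoner to the avoided room. -/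
lemma Alt.through (h : Alt σ s q (s.rooms i)) (hqp : q ≠ p) :
    Alt σ (pstep σ (p, i) s) q (resp σ s p (s.rooms i)) := by
  obtain ⟨l, hh, hd, hc, X, hX, hq⟩ := h
  obtain ⟨h1, h2, h3⟩ := alt_pstep_aux (p := p) hh hd hc hX
  refine ⟨_, h1, h2, h3, X, ?_, ?_⟩
  · rw [run_append, run_singleton]
    simp [pstep, resp, hh, hX]
  · simp [hq, hqp]

variable (σ) in
/-- As long as `p` only sees configurations from `A`, he changes nothing. -/
def Frozen (A : Set Bool) (s : PState n r Bool) (p : Fin n) : Prop :=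
  ∀ cs : List Bool, (∀ c ∈ cs, c ∈ A) → ∀ c ∈ A,
    (σ p (s.hist p ++ cs.map fun c => (c, c)) c).1 = c

lemma Frozen.resp_eq {A : Set Bool} (h : Frozen σ A s p) (hc : c ∈ A) : resp σ s p c = c := by
  simpa [resp] using h [] (by simp) c hc

lemma Frozen.pstep_of_ne {A : Set Bool} (h : Frozen σ A s q) (hqp : q ≠ p) :
    Frozen σ A (pstep σ (p, i) s) q := by
  simpa [Frozen, pstep, Function.update_of_ne hqp] using h

lemma Frozen.pstep {A : Set Bool} (h : Frozen σ A s q) (hc : s.rooms i ∈ A) :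
    Frozen σ A (pstep σ (p, i) s) q := by
  rcases eq_or_ne q p with rfl | hqp
  · intro cs hcs d hd
    have h1 : (σ q (s.hist q) (s.rooms i)).1 = s.rooms i := h.resp_eq hc
    have := h (s.rooms i :: cs) (by simpa [hc] using hcs) d hd
    simpa [_root_.pstep, h1] using this
  · exact h.pstep_of_ne hqp

/-- A prisoner who is not frozen can be led to change a configuration. -/
lemma exists_run_resp_flip {A : Set Bool} (hA : ∀ c ∈ A, 2 ≤ count s.rooms c)
    (h : ¬ Frozen σ A s p) :
    ∃ m, ∃ c ∈ A, (run σ s m).rooms = s.rooms ∧ (∀ q x, Alt σ s q x → Alt σ (run σ s m) q x) ∧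
      resp σ (run σ s m) p c = !c := by
  simp only [Frozen, not_forall] at h
  obtain ⟨cs, hcs, c, hc, h⟩ := h
  induction cs generalizing s with
  | nil => exact ⟨[], c, hc, rfl, fun _ _ h => h, Bool.eq_not.2 (by simpa [run, resp] using h)⟩
  | cons d cs ih =>
    have hd : d ∈ A := hcs d (by simp)
    by_cases hr : resp σ s p d = d
    · obtain ⟨j, rfl⟩ := exists_of_count_pos s.rooms ((hA d hd).trans' one_le_two)
      have hr' : (σ p (s.hist p) (s.rooms j)).1 = s.rooms j := hr
      have hrooms : (pstep σ (p, j) s).rooms = s.rooms := by simp [pstep, hr']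
      obtain ⟨m, c, hc, h1, h2, h3⟩ := ih (s := pstep σ (p, j) s) (by rwa [hrooms])
        (fun c hc => hcs c (by simp [hc])) (by simpa [pstep, hr'] using h)
      exact ⟨(p, j) :: m, c, hc, h1.trans hrooms,
        fun q x h => h2 q x (h.keep fun _ => hA _ hd), h3⟩
    · exact ⟨[], d, hd, rfl, fun _ _ h => h, Bool.eq_not.2 hr⟩

variable (σ) in
/-- At most one pair `(q, x)` fails to satisfy `Alt`. -/
def AlmostFree (s : PState n r Bool) : Prop :=
  ∃ q₀ x₀, ∀ q x, (q, x) ≠ (q₀, x₀) → Alt σ s q x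

variable (σ) in
/-- The positions between which the adversary moves. -/
def Good (s : PState n r Bool) : Prop :=
  ((∀ v, 2 ≤ count s.rooms v) ∧ AlmostFree σ s) ∨
  (∃ v, count s.rooms v ≤ 1 ∧ (∀ q, Alt σ s q (!v)) ∧ ∀ q, Frozen σ {!v} s q) ∨
  (∃ b, Frozen σ Set.univ s b ∧ ∀ x, 2 ≤ count s.rooms x → Alt σ s b x)

variable (σ) in
/-- A good position can be reached from `s` by further visits. -/
def Settles (s : PState n r Bool) : Prop := ∃ m, Good σ (run σ s m)

lemma Good.settles (h : Good σ s) : Settles σ s := ⟨[], h⟩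

lemma Settles.of_run {m : List (Fin n × Fin r)} (h : Settles σ (run σ s m)) : Settles σ s := by
  obtain ⟨m', h⟩ := h
  exact ⟨m ++ m', by rwa [run_append]⟩

lemma Settles.of_pstep {v : Fin n × Fin r} (h : Settles σ (_root_.pstep σ v s)) : Settles σ s :=
  Settles.of_run (m := [v]) h

lemma count_pair {v : Bool} (h : 2 ≤ count s.rooms v) (h' : 2 ≤ count s.rooms (!v)) :
    ∀ w, 2 ≤ count s.rooms w := by
  intro w
  cases v <;> cases w <;> assumption

lemma settles_of_count_eq_one (hr : 5 ≤ r) {v : Bool} (hv : count s.rooms v = 1)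
    (hq : ∀ q, Alt σ s q (!v)) : Settles σ s := by
  have hsum := count_add_count_not s.rooms v
  by_cases hf : ∀ q, Frozen σ {!v} s q
  · exact Good.settles (.inr (.inl ⟨v, hv.le, hq, hf⟩))
  push Not at hf
  obtain ⟨p, hp⟩ := hf
  obtain ⟨m, c, hc, h1, h2, h3⟩ := exists_run_resp_flip (by simp; omega) hp
  obtain rfl : c = !v := hc
  refine Settles.of_run (m := m) ?_
  obtain ⟨j, hj⟩ := exists_of_count_pos (run σ s m).rooms (v := !v) (by rw [h1]; omega)
  refine Settles.of_pstep (v := (p, j)) (Good.settles (.inl ⟨?_, p, v, fun q x hqx => ?_⟩))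
  · have := count_pstep_of_flip hj h3
    rw [h1, Bool.not_not] at this
    exact count_pair (v := v) (by omega) (by omega)
  · by_cases hx : x = v
    · subst hx
      have := Alt.through (p := p) (i := j) (hj ▸ h2 q _ (hq q)) (by simpa using hqx)
      rwa [hj, h3, Bool.not_not] at this
    · rw [Bool.eq_not.2 hx]
      exact (h2 q _ (hq q)).keep fun _ => by rw [hj, h1]; omega

lemma settles_of_count_eq_zero (hr : 5 ≤ r) {v : Bool} (hv : count s.rooms v = 0)
    (hq : ∀ q, Alt σ s q (!v)) : Settles σ s := by
  have hsum := count_add_count_not s.rooms v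
  by_cases hf : ∀ q, Frozen σ {!v} s q
  · exact Good.settles (.inr (.inl ⟨v, by omega, hq, hf⟩))
  push Not at hf
  obtain ⟨p, hp⟩ := hf
  obtain ⟨m, c, hc, h1, h2, h3⟩ := exists_run_resp_flip (by simp; omega) hp
  obtain rfl : c = !v := hc
  refine Settles.of_run (m := m) ?_
  obtain ⟨j, hj⟩ := exists_of_count_pos (run σ s m).rooms (v := !v) (by rw [h1]; omega)
  refine Settles.of_pstep (v := (p, j)) (settles_of_count_eq_one hr (v := v) ?_ fun q => ?_)
  · have := count_pstep_of_flip hj h3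
    rw [h1, Bool.not_not] at this
    omega
  · exact (h2 q _ (hq q)).keep fun _ => by rw [hj, h1]; omega

lemma settles_of_count_le_one (hr : 5 ≤ r) {v : Bool} (hv : count s.rooms v ≤ 1)
    (hq : ∀ q, Alt σ s q (!v)) : Settles σ s := by
  rcases Nat.le_one_iff_eq_zero_or_eq_one.1 hv with h | h
  · exact settles_of_count_eq_zero hr h hq
  · exact settles_of_count_eq_one hr h hq

/-- A prisoner who never changes anything stays unable to cover all rooms. -/
lemma good_pstep_of_frozen_univ (hr : 5 ≤ r) {b : Fin n} (hb : Frozen σ Set.univ s b)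
    (h : ∀ x, 2 ≤ count s.rooms x → Alt σ s b x) (p : Fin n) (i : Fin r) :
    Good σ (pstep σ (p, i) s) := by
  refine .inr (.inr ⟨b, hb.pstep (Set.mem_univ _), fun x hx => ?_⟩)
  obtain ⟨c, hc⟩ : ∃ c, s.rooms i = c := ⟨_, rfl⟩
  by_cases hflip : resp σ s p c = c
  · rw [count_pstep_of_eq (by rw [hc, hflip])] at hx
    exact (h x hx).keep fun hxi => hxi ▸ hx
  have hflip : resp σ s p c = !c := Bool.eq_not.2 hflip
  have hbp : b ≠ p := by
    rintro rfl
    simp [hb.resp_eq (Set.mem_univ c)] at hflip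
  have hcount := count_pstep_of_flip hc hflip
  have hsum := count_add_count_not s.rooms c
  by_cases hxc : x = c
  · subst hxc
    exact (h x (by omega)).keep fun _ => by rw [hc]; omega
  obtain rfl : x = !c := Bool.eq_not.2 hxc
  by_cases h2 : 2 ≤ count s.rooms (!c)
  · exact (h _ h2).keep fun hxi => by simp [hc] at hxi
  · have := Alt.through (p := p) (i := i) (hc ▸ h c (by omega)) hbp
    rwa [hc, hflip] at this

/-- From a good position any requested visit can be made on the way to a good position. -/
lemma Good.exists_run (hn : 2 ≤ n) (hr : 5 ≤ r) (h : Good σ s) (p : Fin n) (i : Fin r) :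
    ∃ m, (p, i) ∈ m ∧ Good σ (run σ s m) := by
  suffices h : ∃ m, Settles σ (pstep σ (p, i) (run σ s m)) by
    obtain ⟨m, m', h⟩ := h
    exact ⟨m ++ [(p, i)] ++ m', by simp, by rwa [run_append, run_append, run_singleton]⟩
  obtain ⟨c, hc⟩ : ∃ c, s.rooms i = c := ⟨_, rfl⟩
  have hsum := count_add_count_not s.rooms c
  rcases h with ⟨h2, q₀, x₀, hfree⟩ | ⟨v, hv, hq, hf⟩ | ⟨b, hb, h⟩
  · have hkeep : ∀ q x, Alt σ s q x → Alt σ (pstep σ (p, i) s) q x := fun q x h =>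
      h.keep fun _ => h2 _
    by_cases hflip : resp σ s p c = c
    · refine ⟨[], Good.settles (.inl ⟨fun v => ?_, q₀, x₀, fun q x h => hkeep q x (hfree q x h)⟩)⟩
      rw [run, List.foldl_nil, count_pstep_of_eq (by rw [hc, hflip])]
      exact h2 v
    have hflip : resp σ s p c = !c := Bool.eq_not.2 hflip
    have hcount := count_pstep_of_flip hc hflip
    have hc2 := h2 c
    have hnc2 := h2 (!c)
    by_cases hc3 : 3 ≤ count s.rooms c
    · exact ⟨[], Good.settles (.inl ⟨count_pair (v := c) (by simp only [run, List.foldl_nil]; omega)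
        (by simp only [run, List.foldl_nil]; omega),
        q₀, x₀, fun q x h => hkeep q x (hfree q x h)⟩)⟩
    by_cases hp : Alt σ s p (!c)
    · refine ⟨[], settles_of_count_le_one hr (v := c) (by simp only [run, List.foldl_nil]; omega)
        fun q => ?_⟩
      by_cases hqc : Alt σ s q (!c)
      · exact hkeep _ _ hqc
      have hqp : q ≠ p := fun h => hqc (h ▸ hp)
      have h0 : (q, !c) = (q₀, x₀) := not_not.1 fun h => hqc (hfree _ _ h)
      have := Alt.through (p := p) (i := i) (hc ▸ hfree q c (by simp [← h0])) hqp
      rwa [hc, hflip] at this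
    have h0 : (p, !c) = (q₀, x₀) := not_not.1 fun h => hp (hfree _ _ h)
    rw [← h0] at hfree
    obtain ⟨b, hbp⟩ : ∃ b, b ≠ p :=
      have : Nontrivial (Fin n) := Fin.nontrivial_iff_two_le.2 hn
      exists_ne p
    have hb_alt : ∀ x, Alt σ s b x := fun x => hfree b x (by simp [hbp])
    by_cases hb : Frozen σ Set.univ s b
    · exact ⟨[], (good_pstep_of_frozen_univ hr hb (fun x _ => hb_alt x) p i).settles⟩
    obtain ⟨m, d, -, h1, hmkeep, h3⟩ := exists_run_resp_flip (fun c _ => h2 c) hb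
    obtain ⟨j, hji, hj⟩ := exists_ne_of_two_le_count (run σ s m).rooms (h1 ▸ h2 d) i
    have hjcount := count_pstep_of_flip hj h3
    have hjkeep : ∀ q x, Alt σ s q x → Alt σ (pstep σ (b, j) (run σ s m)) q x := fun q x h =>
      (hmkeep q x h).keep fun _ => h1 ▸ h2 _
    have hi : (pstep σ (b, j) (run σ s m)).rooms i = c := by
      simp [pstep, Function.update_of_ne hji.symm, h1, hc]
    have hthrough : d = c → Alt σ (pstep σ (b, j) (run σ s m)) p (!c) := by
      rintro rfl
      have := Alt.through (p := b) (i := j) (hj ▸ hmkeep p d (hfree p d (by simp))) hbp.symm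
      rwa [hj, h3] at this
    refine ⟨m ++ [(b, j)], ?_⟩
    rw [run_append, run_singleton]
    rw [h1] at hjcount
    generalize pstep σ (b, j) (run σ s m) = u at *
    have hi' := count_pstep (σ := σ) (s := u) (p := p) (i := i)
    by_cases hdc : d = c
    · subst hdc
      refine settles_of_count_le_one hr (v := d) ?_ fun q => ?_
      · have := hi' d
        simp only [hi] at this
        split_ifs at this <;> omega
      · refine Alt.keep ?_ fun h => by simp [hi] at h
        rcases eq_or_ne q p with rfl | hqp
        · exact hthrough rfl
        · exact hjkeep _ _ (hfree _ _ (by simp [hqp]))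
    · obtain rfl : d = !c := Bool.eq_not.2 hdc
      rw [Bool.not_not] at hjcount
      refine Good.settles (.inl ⟨count_pair (v := c) ?_ ?_, p, !c, fun q x h =>
        (hjkeep q x (hfree q x h)).keep fun _ => by rw [hi]; omega⟩)
      · have := hi' c
        simp only [hi] at this
        split_ifs at this <;> omega
      · have := hi' (!c)
        rw [hi, if_neg (by simp)] at this
        omega
  · refine ⟨[], ?_⟩
    by_cases hcv : c = v
    · subst hcv
      refine settles_of_count_le_one hr (v := c) ?_ fun q => (hq q).keep fun h => by simp [hc] at h
      have := count_pstep (σ := σ) (s := s) (p := p) (i := i) c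
      simp only [hc] at this
      simp only [run, List.foldl_nil]
      split_ifs at this <;> omega
    · obtain rfl : c = !v := Bool.eq_not.2 hcv
      rw [Bool.not_not] at hsum
      refine Good.settles (.inr (.inl ⟨v, ?_, fun q => (hq q).keep fun _ => ?_, fun q =>
        (hf q).pstep hc⟩))
      · rwa [run, List.foldl_nil, count_pstep_of_eq]
        rw [hc, (hf p).resp_eq rfl]
      · rw [hc]
        omega
  · exact ⟨[], (good_pstep_of_frozen_univ hr hb h p i).settles⟩

lemma Good.exists_alt (hn : 2 ≤ n) (hr : 5 ≤ r) (h : Good σ s) : ∃ q x, Alt σ s q x := by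
  rcases h with ⟨-, q₀, x₀, h⟩ | ⟨v, -, h, -⟩ | ⟨b, -, h⟩
  · exact ⟨q₀, !x₀, h _ _ (by simp)⟩
  · exact ⟨⟨0, by omega⟩, !v, h _⟩
  · have := count_add_count_not s.rooms true
    by_cases h2 : 2 ≤ count s.rooms true
    · exact ⟨b, _, h _ h2⟩
    · exact ⟨b, !true, h _ (by omega)⟩

variable (σ) in
lemma settles_start (hr : 5 ≤ r) : Settles σ (start n r) := by
  refine settles_of_count_le_one hr (v := true) (by simp [count, start]) fun q => ?_
  exact ⟨[], rfl, rfl, rfl, ⟨0, by omega⟩, rfl, by simp⟩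

end Run

lemma exists_seq_frequently_eq (α : Type*) [Countable α] [Nonempty α] :
    ∃ f : ℕ → α, ∀ a N, ∃ t ≥ N, f t = a := by
  obtain ⟨g, hg⟩ := exists_surjective_nat α
  refine ⟨fun t => g t.unpair.2, fun a N => ?_⟩
  obtain ⟨k, rfl⟩ := hg a
  exact ⟨Nat.pair N k, Nat.left_le_pair N k, by simp⟩

lemma validSchedule_of_frequently {n r : ℕ} {sch : Schedule n r}
    (h : ∀ v N, ∃ t ≥ N, sch t = v) : ValidSchedule sch := fun p i =>
  Set.infinite_of_forall_exists_gt fun N => by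
    obtain ⟨t, ht, h⟩ := h (p, i) (N + 1)
    exact ⟨t, h, ht⟩

lemma exists_validSchedule_extending {n r : ℕ} [NeZero n] [NeZero r]
    (l : List (Fin n × Fin r)) :
    ∃ sch : Schedule n r, ValidSchedule sch ∧ ∀ t (ht : t < l.length), sch t = l[t] := by
  obtain ⟨f, hf⟩ := exists_seq_frequently_eq (Fin n × Fin r)
  refine ⟨fun t => if h : t < l.length then l[t] else f t,
    validSchedule_of_frequently fun v N => ?_, fun t ht => by simp [ht]⟩
  obtain ⟨t, ht, h⟩ := hf v (N + l.length)
  exact ⟨t, by omega, by simp [show ¬ t < l.length by omega, h]⟩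

/-- If every list satisfying `P` can be prolonged, through any prescribed element, to a list
satisfying `P`, then there is a sequence that meets every element infinitely often and has
arbitrarily long initial segments satisfying `P`. -/
lemma exists_seq_of_prolong {α : Type*} [Countable α] [Nonempty α] (P : List α → Prop)
    {l₀ : List α} (h₀ : P l₀) (h : ∀ l, P l → ∀ a, ∃ m, a ∈ m ∧ P (l ++ m)) :
    ∃ f : ℕ → α, (∀ a N, ∃ t ≥ N, f t = a) ∧
      ∀ N, ∃ l, P l ∧ N ≤ l.length ∧ ∀ t (ht : t < l.length), f t = l[t] := by
  obtain ⟨g, hg⟩ := exists_seq_frequently_eq α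
  choose! m hm hP using h
  let L : ℕ → List α := fun k => Nat.rec l₀ (fun k l => l ++ m l (g k)) k
  have hL : ∀ k, L (k + 1) = L k ++ m (L k) (g k) := fun _ => rfl
  have hPL : ∀ k, P (L k) := fun k => by
    induction k with
    | zero => exact h₀
    | succ k ih => exact hP _ ih _
  have hlen : ∀ k, k ≤ (L k).length := fun k => by
    induction k with
    | zero => exact Nat.zero_le _
    | succ k ih =>
      have := List.length_pos_of_mem (hm (L k) (hPL k) (g k))
      rw [hL, List.length_append]
      omega
  have hpre : ∀ j k, j ≤ k → L j <+: L k := fun j k hjk => by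
    induction k, hjk using Nat.le_induction with
    | base => exact List.prefix_rfl
    | succ k _ ih => exact ih.trans (hL k ▸ List.prefix_append _ _)
  have hget : ∀ k t (ht : t < (L k).length),
      (L (t + 1))[t]'(hlen (t + 1)) = (L k)[t] := fun k t ht => by
    rcases le_total (t + 1) k with hk | hk
    · exact (hpre _ _ hk).getElem _
    · exact ((hpre _ _ hk).getElem _).symm
  refine ⟨fun t => (L (t + 1))[t]'(hlen (t + 1)), fun a N => ?_,
    fun N => ⟨L N, hPL N, hlen N, hget N⟩⟩
  obtain ⟨k, hk, rfl⟩ := hg a N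
  obtain ⟨j, hj, hjm⟩ := List.getElem_of_mem (hm (L k) (hPL k) (g k))
  refine ⟨(L k).length + j, (hk.trans (hlen k)).trans (Nat.le_add_right _ _), ?_⟩
  refine (hget (k + 1) _ (by rw [hL, List.length_append]; omega)).trans ?_
  simp [hL, hjm]

end OneSwitch

/-- with a single switch per room (2 configurations), `n ≥ 2`
prisoners and `r ≥ 5` rooms, all rooms known to start Off, there is no winning
strategy: for every deterministic strategy there is a valid schedule under
which the prisoners either declare incorrectly or never declare. -/
theorem one_switch_insufficient (n r : ℕ) (hn : 2 ≤ n) (hr : 5 ≤ r)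
    (σ : Strategy n Bool) :
    ∃ sch : Schedule n r, ValidSchedule sch ∧
      ((∃ t, (prun σ sch (fun _ => false) t).declared = true ∧
          ∃ (p : Fin n) (rm : Fin r), ¬ VisitedBy sch t p rm) ∨
        (∀ t, (prun σ sch (fun _ => false) t).declared = false)) := by
  have : NeZero n := ⟨by omega⟩
  have : NeZero r := ⟨by omega⟩
  by_contra! hwin
  obtain ⟨m₀, h₀⟩ := OneSwitch.settles_start (n := n) σ hr
  obtain ⟨sch, hvalid, hsch⟩ := OneSwitch.exists_seq_of_prolong
    (fun l => OneSwitch.Good σ (OneSwitch.run σ (OneSwitch.start n r) l)) h₀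
    fun l hl v => by simpa only [OneSwitch.run_append] using hl.exists_run hn hr v.1 v.2
  obtain ⟨t, ht⟩ := (hwin sch (OneSwitch.validSchedule_of_frequently hvalid)).2
  obtain ⟨l, hl, htl, hsl⟩ := hsch t
  have hdec := OneSwitch.declared_mono σ sch htl (by simpa using ht)
  rw [OneSwitch.prun_length_eq_run σ hsl] at hdec
  obtain ⟨q, x, l', -, hd, -, X, -, hX⟩ := hl.exists_alt hn hr
  obtain ⟨sch', hvalid', hsch'⟩ := OneSwitch.exists_validSchedule_extending l'
  obtain ⟨u, hu, hvis⟩ := (hwin sch' hvalid').1 l'.length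
    (by rw [OneSwitch.prun_length_eq_run σ hsch', hd, hdec]) q X
  exact hX (hvis ▸ hsch' u hu ▸ List.getElem_mem hu)
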